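/- For every d ≥ 3, there exists a locally finite, connected, infinite, d-regular simple graph G that contains a cycle and satisfies p_c(G) = 1/(d-1). (In particular, by the main theorem, such G is not quasi-transitive.) -/

import Mathlib

open MeasureTheory
open scoped Classical ENNReal

/-- The Bernoulli measure on `Bool` with parameter `p` (`true` = open, with prob. `p`). -/
noncomputable def bernoulliMeasure (p : ℝ) : Measure Bool :=
  ENNReal.ofReal p • Measure.dirac true + ENNReal.ofReal (1 - p) • Measure.dirac false

/-- The Bernoulli(`p`) product measure on configurations `ι → Bool`, realized as the
Carathéodory-extension outer measure of the product premeasure; on measurable sets it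
is the usual i.i.d. Bernoulli product probability measure. -/
noncomputable def bernoulliProduct (ι : Type*) (p : ℝ) : OuterMeasure (ι → Bool) :=
  OuterMeasure.ofFunction
    (fun A : Set (ι → Bool) =>
      if A = ∅ then 0 else ∏' i : ι, bernoulliMeasure p (Function.eval i '' A))
    (by simp)

/-- The subgraph of open edges of the configuration `ω` (an edge `e` is open iff `ω e = true`). -/
def openSubgraph {V : Type*} (G : SimpleGraph V) (ω : G.edgeSet → Bool) : SimpleGraph V :=
  G.deleteEdges {e : Sym2 V | ∃ h : e ∈ G.edgeSet, ω ⟨e, h⟩ = false}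

/-- The event that the open subgraph has an infinite connected component. -/
def HasInfiniteCluster {V : Type*} (G : SimpleGraph V) (ω : G.edgeSet → Bool) : Prop :=
  ∃ v : V, {w : V | (openSubgraph G ω).Reachable v w}.Infinite

/-- The critical percolation threshold
`p_c(G) = sup {p ∈ [0,1] | ℙ_p(∃ an infinite connected component) = 0}`. -/
noncomputable def pc {V : Type*} (G : SimpleGraph V) : ℝ :=
  sSup {p : ℝ | p ∈ Set.Icc (0 : ℝ) 1 ∧
    bernoulliProduct G.edgeSet p {ω | HasInfiniteCluster G ω} = 0}

theorem ENNReal.hasProd_iInf_of_le_one {ι : Type*} {f : ι → ℝ≥0∞} (hf : ∀ i, f i ≤ 1) :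
    HasProd f (⨅ s : Finset ι, ∏ i ∈ s, f i) :=
  tendsto_atTop_iInf fun _ _ h =>
    Finset.prod_le_prod_of_subset_of_le_one' h fun i _ _ => hf i

theorem ENNReal.tprod_eq_iInf_of_le_one {ι : Type*} {f : ι → ℝ≥0∞} (hf : ∀ i, f i ≤ 1) :
    ∏' i, f i = ⨅ s : Finset ι, ∏ i ∈ s, f i :=
  (ENNReal.hasProd_iInf_of_le_one hf).tprod_eq

theorem isProbabilityMeasure_bernoulliMeasure {p : ℝ} (hp : p ∈ Set.Icc (0 : ℝ) 1) :
    IsProbabilityMeasure (bernoulliMeasure p) where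
  measure_univ := by
    simp [bernoulliMeasure, ← ENNReal.ofReal_add hp.1 (sub_nonneg.2 hp.2)]

theorem bernoulliMeasure_singleton_true (p : ℝ) :
    bernoulliMeasure p {true} = ENNReal.ofReal p := by
  simp [bernoulliMeasure]

theorem infinitePi_le_bernoulliProduct {ι : Type*} {p : ℝ}
    [IsProbabilityMeasure (bernoulliMeasure p)] (A : Set (ι → Bool)) :
    Measure.infinitePi (fun _ : ι => bernoulliMeasure p) A ≤ bernoulliProduct ι p A := by
  have key : (Measure.infinitePi (fun _ : ι => bernoulliMeasure p)).toOuterMeasure ≤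
      bernoulliProduct ι p := by
    refine OuterMeasure.le_ofFunction.2 fun A => ?_
    split_ifs with hA
    · simp [hA]
    · rw [ENNReal.tprod_eq_iInf_of_le_one fun _ => prob_le_one]
      refine le_iInf fun s => ?_
      rw [← Measure.infinitePi_pi (μ := fun _ : ι => bernoulliMeasure p)
        (t := fun i => Function.eval i '' A) fun _ _ => MeasurableSet.of_discrete]
      exact measure_mono fun ω hω i _ => ⟨ω, hω, rfl⟩
  exact key A

theorem bernoulliProduct_forall_mem_le {ι : Type*} {p : ℝ} (hp : p ∈ Set.Icc (0 : ℝ) 1)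
    (s : Finset ι) :
    bernoulliProduct ι p {ω | ∀ i ∈ s, ω i = true} ≤ ENNReal.ofReal p ^ s.card := by
  have := isProbabilityMeasure_bernoulliMeasure hp
  refine (OuterMeasure.ofFunction_le _).trans ?_
  split_ifs
  · exact zero_le
  rw [ENNReal.tprod_eq_iInf_of_le_one fun _ => prob_le_one]
  refine (iInf_le _ s).trans (Finset.prod_le_pow_card _ _ _ fun i hi => ?_)
  rw [← bernoulliMeasure_singleton_true]
  refine measure_mono ?_
  rintro _ ⟨ω, hω, rfl⟩
  exact hω i hi

section Branching

variable {Ω α : Type*}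

/-- The event that, in the tree of lists where `a :: l` is a child of `l`, the edge above `l` is
open and continues to an open path through `n` further generations. -/
def branchEvent (X : List α → Ω → Bool) : ℕ → List α → Set Ω
  | 0, l => {ω | X l ω = true}
  | n + 1, l => {ω | X l ω = true} ∩ ⋃ a, branchEvent X n (a :: l)

theorem branchEvent_subset (X : List α → Ω → Bool) (n : ℕ) (l : List α) :
    branchEvent X n l ⊆ {ω | X l ω = true} := by
  cases n with
  | zero => exact subset_rfl
  | succ n => exact Set.inter_subset_left

theorem branchEvent_succ_subset (X : List α → Ω → Bool) (n : ℕ) (l : List α) :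
    branchEvent X (n + 1) l ⊆ branchEvent X n l := by
  induction n generalizing l with
  | zero => exact Set.inter_subset_left
  | succ n ih => exact Set.inter_subset_inter_right _ (Set.iUnion_mono fun a => ih (a :: l))

theorem measurableSet_branchEvent [Countable α] (X : List α → Ω → Bool) (n : ℕ) (l : List α) :
    MeasurableSet[⨆ i ∈ {m | l <:+ m}, MeasurableSpace.comap (X i) ⊤] (branchEvent X n l) := by
  have hX (l : List α) : MeasurableSet[⨆ i ∈ {m | l <:+ m}, MeasurableSpace.comap (X i) ⊤]
      {ω | X l ω = true} :=
    (le_iSup₂_of_le l (List.suffix_refl l) le_rfl :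
      MeasurableSpace.comap (X l) ⊤ ≤ ⨆ i ∈ {m | l <:+ m}, MeasurableSpace.comap (X i) ⊤) _
      ⟨{true}, trivial, rfl⟩
  induction n generalizing l with
  | zero => exact hX l
  | succ n ih =>
    refine MeasurableSet.inter (hX l) (MeasurableSet.iUnion fun a => ?_)
    refine (biSup_mono fun m hm => ?_ :
      _ ≤ ⨆ i ∈ {m | l <:+ m}, MeasurableSpace.comap (X i) ⊤) _ (ih (a :: l))
    exact (List.suffix_cons a l).trans hm

variable [MeasurableSpace Ω] {μ : Measure Ω}

theorem ProbabilityTheory.iIndepFun.measureReal_inter_of_disjoint {ι : Type*} {X : ι → Ω → Bool}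
    (hX : ∀ i, Measurable (X i)) (hind : ProbabilityTheory.iIndepFun X μ) {S T : Set ι}
    (hST : Disjoint S T) {A B : Set Ω}
    (hA : MeasurableSet[⨆ i ∈ S, MeasurableSpace.comap (X i) ⊤] A)
    (hB : MeasurableSet[⨆ i ∈ T, MeasurableSpace.comap (X i) ⊤] B) :
    μ.real (A ∩ B) = μ.real A * μ.real B := by
  have h := ProbabilityTheory.indep_iSup_of_disjoint
    (fun i => (hX i).comap_le) hind hST
  simp only [measureReal_def, ← ENNReal.toReal_mul]
  rw [(ProbabilityTheory.Indep_iff _ _ μ).1 h A B hA hB]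

theorem one_sub_one_sub_pow_ge {k : ℕ} {p c : ℝ} (hp : 0 ≤ p) (hp1 : p ≤ 1) (hc : 0 ≤ c)
    (h : k * p * c + 1 ≤ k * p) : c ≤ 1 - (1 - p * c) ^ k := by
  have hc1 : c ≤ 1 := by
    by_contra! hlt
    nlinarith [mul_nonneg (Nat.cast_nonneg (α := ℝ) k) hp]
  have hx0 : 0 ≤ p * c := mul_nonneg hp hc
  have hx1 : p * c ≤ 1 := mul_le_one₀ hp1 hc hc1
  have h1 : 1 + k * (p * c) ≤ (1 + p * c) ^ k :=
    one_add_mul_le_pow (by linarith) k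
  have h2 : (1 - p * c) ^ k * (1 + p * c) ^ k ≤ 1 := by
    rw [← mul_pow]
    exact pow_le_one₀ (mul_nonneg (by linarith) (by linarith)) (by nlinarith)
  have h3 : (1 - p * c) ^ k * (1 + k * (p * c)) ≤ 1 :=
    (mul_le_mul_of_nonneg_left h1 (pow_nonneg (by linarith) k)).trans h2
  have h4 : 1 ≤ (1 - c) * (1 + k * (p * c)) := by nlinarith
  have h5 : 0 < 1 + k * (p * c) := by positivity
  have h6 := le_of_mul_le_mul_right (h3.trans h4) h5
  linarith

theorem le_measureReal_branchEvent [Fintype α] [IsProbabilityMeasure μ] {X : List α → Ω → Bool}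
    (hX : ∀ l, Measurable (X l)) (hind : ProbabilityTheory.iIndepFun X μ) {p c : ℝ}
    (hp : p ≤ 1) (hXp : ∀ l, μ.real {ω | X l ω = true} = p) (hc : 0 ≤ c)
    (h : Fintype.card α * p * c + 1 ≤ Fintype.card α * p) (n : ℕ) (l : List α) :
    p * c ≤ μ.real (branchEvent X n l) := by
  have hp0 : 0 ≤ p := hXp [] ▸ measureReal_nonneg
  have hc1 : c ≤ 1 := by
    by_contra! hlt
    nlinarith [mul_nonneg (Nat.cast_nonneg (α := ℝ) (Fintype.card α)) hp0]
  have hle (l : List α) :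
      ⨆ i ∈ {m | l <:+ m}, MeasurableSpace.comap (X i) ⊤ ≤ ‹MeasurableSpace Ω› :=
    iSup₂_le fun i _ => (hX i).comap_le
  have hmeas (n l) : MeasurableSet (branchEvent X n l) :=
    hle l _ (measurableSet_branchEvent X n l)
  induction n generalizing l with
  | zero => exact (mul_le_of_le_one_right hp0 hc1).trans_eq (hXp l).symm
  | succ n ih =>
    have hdisj : ∀ s : Finset α, μ.real (⋂ a ∈ s, (branchEvent X n (a :: l))ᶜ) ≤
        (1 - p * c) ^ s.card := by
      intro s
      induction s using Finset.induction_on with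
      | empty => simp
      | insert a s ha ihs =>
        rw [Finset.set_biInter_insert, Finset.card_insert_of_notMem ha, pow_succ',
          hind.measureReal_inter_of_disjoint hX (S := {m | a :: l <:+ m})
            (T := {m | ∃ b ∈ s, b :: l <:+ m})]
        · refine mul_le_mul ?_ ihs measureReal_nonneg ?_
          · rw [probReal_compl_eq_one_sub (hmeas _ _)]
            linarith [ih (a :: l)]
          · nlinarith
        · rw [Set.disjoint_left]
          rintro m hm ⟨b, hb, hbm⟩
          have := (List.suffix_of_suffix_length_le hm hbm (by simp)).eq_of_length (by simp)
          simp only [List.cons.injEq, and_true] at this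
          exact ha (this ▸ hb)
        · exact (measurableSet_branchEvent X n (a :: l)).compl
        · refine Finset.measurableSet_biInter s fun b hb => MeasurableSet.compl ?_
          refine (biSup_mono fun m hm => ⟨b, hb, hm⟩ :
            _ ≤ ⨆ i ∈ {m | ∃ b ∈ s, b :: l <:+ m}, MeasurableSpace.comap (X i) ⊤) _
              (measurableSet_branchEvent X n (b :: l))
    have hunion : c ≤ μ.real (⋃ a, branchEvent X n (a :: l)) := by
      have h1 := hdisj Finset.univ
      have h2 := probReal_compl_eq_one_sub (μ := μ)
        (MeasurableSet.iUnion fun a => hmeas n (a :: l))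
      simp only [Finset.mem_univ, Set.iInter_true, Finset.card_univ] at h1
      rw [Set.compl_iUnion] at h2
      linarith [one_sub_one_sub_pow_ge hp0 hp hc h]
    rw [branchEvent, hind.measureReal_inter_of_disjoint hX (S := {l})
      (T := {m | ∃ a, a :: l <:+ m}), hXp]
    · gcongr
    · rw [Set.disjoint_singleton_left]
      rintro ⟨a, ha⟩
      simpa using ha.length_le
    · exact (le_iSup₂_of_le l rfl le_rfl : MeasurableSpace.comap (X l) ⊤ ≤
        ⨆ i ∈ ({l} : Set (List α)), MeasurableSpace.comap (X i) ⊤) _ ⟨{true}, trivial, rfl⟩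
    · refine MeasurableSet.iUnion fun a => ?_
      exact (biSup_mono fun m hm => ⟨a, hm⟩ :
        _ ≤ ⨆ i ∈ {m | ∃ a, a :: l <:+ m}, MeasurableSpace.comap (X i) ⊤) _
          (measurableSet_branchEvent X n (a :: l))

/-- A Galton–Watson type tree with mean offspring larger than one survives with positive
probability. -/
theorem measureReal_iInter_branchEvent_pos [Fintype α] [IsProbabilityMeasure μ]
    {X : List α → Ω → Bool} (hX : ∀ l, Measurable (X l))
    (hind : ProbabilityTheory.iIndepFun X μ) {p : ℝ} (hp : p ≤ 1)
    (hXp : ∀ l, μ.real {ω | X l ω = true} = p) (h : 1 < Fintype.card α * p) :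
    0 < μ.real (⋂ n, branchEvent X n []) := by
  have hp0 : 0 < p := by
    by_contra! hle
    nlinarith [Nat.cast_nonneg (α := ℝ) (Fintype.card α)]
  set k : ℝ := (Fintype.card α : ℝ)
  have hc : 0 < 1 - 1 / (k * p) := by
    rw [sub_pos, div_lt_one (by linarith)]
    exact h
  have hlim := tendsto_measure_iInter_atTop (μ := μ) (s := fun n => branchEvent X n [])
    (fun n => ((iSup₂_le fun i _ => (hX i).comap_le :
      ⨆ i ∈ {m | [] <:+ m}, MeasurableSpace.comap (X i) ⊤ ≤ ‹MeasurableSpace Ω›) _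
      (measurableSet_branchEvent X n [])).nullMeasurableSet)
    (antitone_nat_of_succ_le fun n => branchEvent_succ_subset X n [])
    ⟨0, measure_ne_top _ _⟩
  have hlim' := (ENNReal.tendsto_toReal (measure_ne_top μ _)).comp hlim
  refine (mul_pos hp0 hc).trans_le (ge_of_tendsto' hlim' fun n => ?_)
  have hkp : k * p * (1 - 1 / (k * p)) + 1 = k * p := by
    rw [mul_sub, mul_one_div_cancel (by linarith)]
    ring
  exact le_measureReal_branchEvent hX hind hp hXp hc.le hkp.le n []

end Branching

section Paths

variable {V : Type*} {G : SimpleGraph V}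

theorem openSubgraph_le (ω : G.edgeSet → Bool) : openSubgraph G ω ≤ G :=
  G.deleteEdges_le _

theorem eq_true_of_mem_edgeSet_openSubgraph {ω : G.edgeSet → Bool} {e : Sym2 V}
    (he : e ∈ (openSubgraph G ω).edgeSet) (h : e ∈ G.edgeSet) : ω ⟨e, h⟩ = true := by
  rw [openSubgraph, SimpleGraph.edgeSet_deleteEdges] at he
  by_contra hω
  exact he.2 ⟨h, by simpa using hω⟩

/-- A self-avoiding walk of positive length in a `(k + 1)`-regular graph extends in at most `k`
ways, so there are at most `(k + 1) * k ^ n` paths of length `n + 1` ending at a given vertex. -/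
theorem exists_finset_paths_card_le {k : ℕ} (hfin : ∀ v, (G.neighborSet v).Finite)
    (hreg : ∀ v, (G.neighborSet v).ncard = k + 1) (v : V) (n : ℕ) :
    ∃ F : Finset (Σ u, G.Walk u v), F.card ≤ (k + 1) * k ^ n ∧
      ∀ (u : V) (q : G.Walk u v), q.IsPath → q.length = n + 1 → ⟨u, q⟩ ∈ F := by
  let ext (q : Σ u, G.Walk u v) (u : V) : Σ u, G.Walk u v :=
    if h : G.Adj u q.1 then ⟨u, .cons h q.2⟩ else q
  have hcard (v : V) : (hfin v).toFinset.card = k + 1 := by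
    rw [← Set.ncard_eq_toFinset_card _ (hfin v), hreg]
  induction n with
  | zero =>
    refine ⟨(hfin v).toFinset.image (ext ⟨v, .nil⟩), ?_, ?_⟩
    · exact Finset.card_image_le.trans (by simp [hcard])
    · intro u q _ hq
      match q with
      | .cons h .nil =>
        exact Finset.mem_image.2 ⟨u, by simpa using h.symm, by simp [ext, h]⟩
  | succ n ih =>
    obtain ⟨F, hF, hmem⟩ := ih
    refine ⟨(F.filter fun q => 0 < q.2.length).biUnion fun q =>
      ((hfin q.1).toFinset.erase q.2.snd).image (ext q), ?_, ?_⟩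
    · rw [pow_succ, ← mul_assoc]
      refine (Finset.card_biUnion_le_card_mul _ _ k fun q hq => ?_).trans
        (Nat.mul_le_mul_right k ((Finset.card_filter_le _ _).trans hF))
      refine Finset.card_image_le.trans ?_
      rw [Finset.card_erase_of_mem, hcard, Nat.add_sub_cancel]
      have hnil : ¬ q.2.Nil := by
        rw [← SimpleGraph.Walk.length_eq_zero_iff]
        exact (Finset.mem_filter.1 hq).2.ne'
      simpa using q.2.adj_snd hnil
    · intro u q hp hq
      match q with
      | .cons (v := w) h r =>
        rw [SimpleGraph.Walk.cons_isPath_iff] at hp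
        rw [SimpleGraph.Walk.length_cons, Nat.add_right_cancel_iff] at hq
        refine Finset.mem_biUnion.2 ⟨⟨w, r⟩, Finset.mem_filter.2
          ⟨hmem w r hp.1 hq, by simp [hq]⟩, Finset.mem_image.2 ⟨u, ?_, by simp [ext, h]⟩⟩
        refine Finset.mem_erase.2 ⟨?_, by simpa using h.symm⟩
        rintro rfl
        exact hp.2 (r.getVert_mem_support 1)

theorem exists_isPath_length_eq_of_infinite {k : ℕ} (hfin : ∀ v, (G.neighborSet v).Finite)
    (hreg : ∀ v, (G.neighborSet v).ncard = k + 1) {H : SimpleGraph V} (hH : H ≤ G) {v : V}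
    (hinf : {w | H.Reachable v w}.Infinite) (n : ℕ) :
    ∃ (u : V) (q : H.Walk u v), q.IsPath ∧ q.length = n := by
  by_contra! hno
  have hlt (u : V) (q : H.Walk u v) (hq : q.IsPath) : q.length < n := by
    by_contra! hle
    refine hno _ (q.drop (q.length - n)) (hq.drop _) ?_
    rw [SimpleGraph.Walk.drop_length]
    omega
  choose F _ hF using exists_finset_paths_card_le hfin hreg v
  refine hinf (((Finset.range n).biUnion fun m => (F m).image Sigma.fst).finite_toSet.insert v
    |>.subset fun u hu => ?_)
  obtain ⟨q, hq⟩ := (SimpleGraph.Reachable.symm hu).exists_isPath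
  rcases hl : q.length with _ | m
  · exact Or.inl (SimpleGraph.Walk.eq_of_length_eq_zero hl)
  · have := hlt u q hq
    refine Or.inr (Finset.mem_coe.2 (Finset.mem_biUnion.2 ⟨m, Finset.mem_range.2 (by omega),
      Finset.mem_image.2 ⟨⟨u, q.mapLe hH⟩, hF m u _ (hq.mapLe hH) (by simpa using hl), rfl⟩⟩))

theorem bernoulliProduct_infinite_cluster_le {k : ℕ} (hfin : ∀ v, (G.neighborSet v).Finite)
    (hreg : ∀ v, (G.neighborSet v).ncard = k + 1) {p : ℝ} (hp : p ∈ Set.Icc (0 : ℝ) 1) (v : V)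
    (n : ℕ) :
    bernoulliProduct G.edgeSet p {ω | {w | (openSubgraph G ω).Reachable v w}.Infinite} ≤
      ENNReal.ofReal ((k + 1) * p * (k * p) ^ n) := by
  obtain ⟨F, hcard, hF⟩ := exists_finset_paths_card_le hfin hreg v n
  let S := F.filter fun q => q.2.IsPath ∧ q.2.length = n + 1
  let E (q : Σ u, G.Walk u v) : Finset G.edgeSet := q.2.edges.toFinset.subtype (· ∈ G.edgeSet)
  have hE (q) (hq : q ∈ S) : (E q).card = n + 1 := by
    obtain ⟨_, hpath, hlen⟩ := Finset.mem_filter.1 hq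
    rw [Finset.card_subtype, Finset.filter_true_of_mem
      fun e he => q.2.edges_subset_edgeSet (List.mem_toFinset.1 he),
      List.toFinset_card_of_nodup hpath.isTrail.edges_nodup, SimpleGraph.Walk.length_edges, hlen]
  have hsub : {ω | {w | (openSubgraph G ω).Reachable v w}.Infinite} ⊆
      ⋃ q ∈ S, {ω : G.edgeSet → Bool | ∀ e ∈ E q, ω e = true} := by
    intro ω hω
    obtain ⟨u, q, hq, hlen⟩ :=
      exists_isPath_length_eq_of_infinite hfin hreg (openSubgraph_le ω) hω (n + 1)
    have hq' := hq.mapLe (openSubgraph_le ω)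
    have hlen' : (q.mapLe (openSubgraph_le ω)).length = n + 1 := by simpa using hlen
    refine Set.mem_biUnion (x := ⟨u, q.mapLe (openSubgraph_le ω)⟩)
      (Finset.mem_filter.2 ⟨hF u _ hq' hlen', hq', hlen'⟩) fun e he => ?_
    rw [Finset.mem_subtype, List.mem_toFinset, SimpleGraph.Walk.edges_mapLe_eq_edges] at he
    exact eq_true_of_mem_edgeSet_openSubgraph (q.edges_subset_edgeSet he) e.2
  calc _ ≤ _ := measure_mono hsub
    _ ≤ ∑ q ∈ S, _ := measure_biUnion_finset_le S _
    _ ≤ ∑ q ∈ S, ENNReal.ofReal p ^ (n + 1) := Finset.sum_le_sum fun q hq => by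
        rw [← hE q hq]
        exact bernoulliProduct_forall_mem_le hp (E q)
    _ = S.card * ENNReal.ofReal p ^ (n + 1) := by rw [Finset.sum_const, nsmul_eq_mul]
    _ ≤ ((k + 1) * k ^ n : ℕ) * ENNReal.ofReal p ^ (n + 1) := by
        gcongr
        exact (Finset.card_filter_le _ _).trans hcard
    _ = _ := by
        rw [← ENNReal.ofReal_natCast, ← ENNReal.ofReal_pow hp.1,
          ← ENNReal.ofReal_mul (Nat.cast_nonneg _)]
        push_cast
        ring_nf

theorem bernoulliProduct_hasInfiniteCluster_eq_zero [Countable V] {k : ℕ}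
    (hfin : ∀ v, (G.neighborSet v).Finite) (hreg : ∀ v, (G.neighborSet v).ncard = k + 1) {p : ℝ}
    (hp : p ∈ Set.Icc (0 : ℝ) 1) (hkp : k * p < 1) :
    bernoulliProduct G.edgeSet p {ω | HasInfiniteCluster G ω} = 0 := by
  simp only [HasInfiniteCluster, Set.ofPred_exists]
  refine measure_iUnion_null fun v => le_antisymm ?_ zero_le
  have hlim := (tendsto_pow_atTop_nhds_zero_of_lt_one
    (mul_nonneg (Nat.cast_nonneg k) hp.1) hkp).const_mul ((k + 1) * p)
  refine ge_of_tendsto' (a := 0) (x := Filter.atTop) ?_ fun n =>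
    bernoulliProduct_infinite_cluster_le hfin hreg hp v n
  simpa using ENNReal.tendsto_ofReal hlim

end Paths

section RegularGraph

/-- The complete graph on `Fin d` with a `(d - 1)`-ary tree hanging from each of its vertices by
an edge. -/
def cliqueWithTrees (d : ℕ) : SimpleGraph (Fin d ⊕ Fin d × List (Fin (d - 1))) where
  Adj
    | .inl i, .inl j => i ≠ j
    | .inl i, .inr (j, l) => i = j ∧ l = []
    | .inr (i, l), .inl j => i = j ∧ l = []
    | .inr (i, l), .inr (j, m) => i = j ∧ ((∃ a, m = a :: l) ∨ ∃ a, l = a :: m)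
  symm := ⟨by rintro (i | ⟨i, l⟩) (j | ⟨j, m⟩) <;> grind⟩
  loopless := ⟨by rintro (i | ⟨i, l⟩) <;> simp⟩

variable {d : ℕ}

theorem cliqueWithTrees_adj_cons (i : Fin d) (a : Fin (d - 1)) (l : List (Fin (d - 1))) :
    (cliqueWithTrees d).Adj (.inr (i, a :: l)) (.inr (i, l)) :=
  ⟨rfl, Or.inr ⟨a, rfl⟩⟩

theorem cliqueWithTrees_neighborSet_inl (i : Fin d) :
    (cliqueWithTrees d).neighborSet (.inl i) = insert (.inr (i, [])) (Sum.inl '' {i}ᶜ) := by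
  ext (j | ⟨j, m⟩) <;> simp [cliqueWithTrees, eq_comm]

theorem cliqueWithTrees_neighborSet_inr_nil (i : Fin d) :
    (cliqueWithTrees d).neighborSet (.inr (i, [])) =
      insert (.inl i) (Set.range fun a => .inr (i, [a])) := by
  ext (j | ⟨j, m⟩) <;> simp [cliqueWithTrees, eq_comm]

theorem cliqueWithTrees_neighborSet_inr_cons (i : Fin d) (b : Fin (d - 1))
    (l : List (Fin (d - 1))) :
    (cliqueWithTrees d).neighborSet (.inr (i, b :: l)) =
      insert (.inr (i, l)) (Set.range fun a => .inr (i, a :: b :: l)) := by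
  ext (j | ⟨j, m⟩)
  · simp [cliqueWithTrees]
  · simp only [cliqueWithTrees, SimpleGraph.mem_neighborSet, Set.mem_insert_iff, Set.mem_range]
    grind

theorem ncard_insert_range {α β : Type*} [Fintype α] {f : α → β} (hf : f.Injective) {b : β}
    (hb : b ∉ Set.range f) : (insert b (Set.range f)).ncard = Fintype.card α + 1 := by
  rw [Set.ncard_insert_of_notMem hb (Set.finite_range f), ← Set.image_univ,
    Set.ncard_image_of_injective _ hf, Set.ncard_univ, Nat.card_eq_fintype_card]

theorem cliqueWithTrees_neighborSet_finite (v : Fin d ⊕ Fin d × List (Fin (d - 1))) :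
    ((cliqueWithTrees d).neighborSet v).Finite := by
  rcases v with i | ⟨i, _ | ⟨b, l⟩⟩
  · rw [cliqueWithTrees_neighborSet_inl]
    exact ((Set.toFinite _).image _).insert _
  · rw [cliqueWithTrees_neighborSet_inr_nil]
    exact (Set.finite_range _).insert _
  · rw [cliqueWithTrees_neighborSet_inr_cons]
    exact (Set.finite_range _).insert _

theorem cliqueWithTrees_neighborSet_ncard (v : Fin d ⊕ Fin d × List (Fin (d - 1))) :
    ((cliqueWithTrees d).neighborSet v).ncard = d - 1 + 1 := by
  rcases v with i | ⟨i, _ | ⟨b, l⟩⟩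
  · rw [cliqueWithTrees_neighborSet_inl, Set.ncard_insert_of_notMem (by simp)
      ((Set.toFinite _).image _), Set.ncard_image_of_injective _ Sum.inl_injective,
      Set.ncard_compl, Set.ncard_singleton, Nat.card_fin]
  · rw [cliqueWithTrees_neighborSet_inr_nil, ncard_insert_range (fun a b h => by simpa using h)
      (by simp), Fintype.card_fin]
  · rw [cliqueWithTrees_neighborSet_inr_cons, ncard_insert_range (fun a b h => by simpa using h),
      Fintype.card_fin]
    rintro ⟨a, ha⟩
    have := congrArg List.length (Prod.ext_iff.1 (Sum.inr_injective ha)).2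
    simp only [List.length_cons] at this
    omega

theorem cliqueWithTrees_connected (hd : 1 ≤ d) : (cliqueWithTrees d).Connected := by
  have hroot (i j : Fin d) : (cliqueWithTrees d).Reachable (.inl i) (.inl j) := by
    rcases eq_or_ne i j with rfl | h
    · rfl
    · exact SimpleGraph.Adj.reachable h
  have htree (i : Fin d) (l) : (cliqueWithTrees d).Reachable (.inr (i, l)) (.inl i) := by
    induction l with
    | nil => exact SimpleGraph.Adj.reachable ⟨rfl, rfl⟩
    | cons a l ih => exact (cliqueWithTrees_adj_cons i a l).reachable.trans ih
  refine SimpleGraph.connected_iff_exists_forall_reachable _ |>.2 ⟨.inl ⟨0, hd⟩, ?_⟩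
  rintro (j | ⟨j, l⟩)
  · exact hroot _ _
  · exact (hroot _ j).trans (htree j l).symm

theorem not_isAcyclic_cliqueWithTrees (hd : 3 ≤ d) : ¬ (cliqueWithTrees d).IsAcyclic := by
  have h01 : (cliqueWithTrees d).Adj (.inl ⟨0, by omega⟩) (.inl ⟨1, by omega⟩) := by
    simp [cliqueWithTrees]
  have h12 : (cliqueWithTrees d).Adj (.inl ⟨1, by omega⟩) (.inl ⟨2, by omega⟩) := by
    simp [cliqueWithTrees]
  have h20 : (cliqueWithTrees d).Adj (.inl ⟨2, by omega⟩) (.inl ⟨0, by omega⟩) := by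
    simp [cliqueWithTrees]
  intro h
  refine h (.cons h01 (.cons h12 (.cons h20 .nil))) ?_
  simp [SimpleGraph.Walk.cons_isCycle_iff]

/-- The edge of `cliqueWithTrees d` joining the vertex `l` of the `i`-th tree to its parent. -/
def parentEdge (i : Fin d) : List (Fin (d - 1)) → (cliqueWithTrees d).edgeSet
  | [] => ⟨s(.inr (i, []), .inl i), by simp [cliqueWithTrees]⟩
  | a :: l => ⟨s(.inr (i, a :: l), .inr (i, l)), cliqueWithTrees_adj_cons i a l⟩

theorem parentEdge_injective (i : Fin d) : (parentEdge i).Injective := by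
  rintro (_ | ⟨a, l⟩) (_ | ⟨b, m⟩) h <;> replace h := congrArg Subtype.val h
  · rfl
  · simp [parentEdge] at h
  · simp [parentEdge] at h
  · simp only [parentEdge, Sym2.eq_iff, Sum.inr.injEq, Prod.mk.injEq,
      true_and] at h
    rcases h with h | ⟨h₁, h₂⟩
    · exact h.1
    · have := congrArg List.length h₁
      have := congrArg List.length h₂
      simp only [List.length_cons] at *
      omega

theorem exists_reachable_of_mem_branchEvent (i : Fin d) (n : ℕ) (l : List (Fin (d - 1)))
    {ω : (cliqueWithTrees d).edgeSet → Bool}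
    (hω : ω ∈ branchEvent (fun l ω => ω (parentEdge i l)) n l) :
    ∃ m : List (Fin (d - 1)), m.length = l.length + n ∧
      (openSubgraph (cliqueWithTrees d) ω).Reachable (.inr (i, l)) (.inr (i, m)) := by
  induction n generalizing l with
  | zero => exact ⟨l, rfl, .rfl⟩
  | succ n ih =>
    obtain ⟨a, ha⟩ := Set.mem_iUnion.1 hω.2
    obtain ⟨m, hm, hreach⟩ := ih (a :: l) ha
    refine ⟨m, by rw [hm, List.length_cons]; omega, SimpleGraph.Reachable.trans ?_ hreach⟩
    refine SimpleGraph.Adj.reachable (SimpleGraph.Adj.symm ?_)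
    have hopen : ω (parentEdge i (a :: l)) = true := branchEvent_subset _ _ _ ha
    rw [openSubgraph, SimpleGraph.deleteEdges_adj]
    refine ⟨cliqueWithTrees_adj_cons i a l, ?_⟩
    rintro ⟨h, hfalse⟩
    exact absurd (hfalse.symm.trans hopen) (by simp)

theorem bernoulliProduct_cliqueWithTrees_ne_zero (hd : 1 ≤ d) {p : ℝ}
    (hp : p ∈ Set.Icc (0 : ℝ) 1) (hdp : 1 < (d - 1 : ℕ) * p) :
    bernoulliProduct (cliqueWithTrees d).edgeSet p
      {ω | HasInfiniteCluster (cliqueWithTrees d) ω} ≠ 0 := by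
  have := isProbabilityMeasure_bernoulliMeasure hp
  let μ := Measure.infinitePi fun _ : (cliqueWithTrees d).edgeSet => bernoulliMeasure p
  let i : Fin d := ⟨0, hd⟩
  have hind : ProbabilityTheory.iIndepFun
      (fun l (ω : (cliqueWithTrees d).edgeSet → Bool) => ω (parentEdge i l)) μ :=
    (ProbabilityTheory.iIndepFun_infinitePi (X := fun _ => id) fun _ => measurable_id).precomp
      (parentEdge_injective i)
  have hX (l : List (Fin (d - 1))) : μ.real {ω | ω (parentEdge i l) = true} = p := by
    have h := Measure.infinitePi_pi (μ := fun _ : (cliqueWithTrees d).edgeSet =>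
      bernoulliMeasure p) (s := {parentEdge i l}) (t := fun _ => {true})
      fun _ _ => MeasurableSet.of_discrete
    rw [Finset.prod_singleton, bernoulliMeasure_singleton_true] at h
    have hset : {ω : (cliqueWithTrees d).edgeSet → Bool | ω (parentEdge i l) = true} =
        Set.pi ({parentEdge i l} : Finset _) fun _ => {true} := by
      ext ω
      simp
    rw [measureReal_def, hset, h, ENNReal.toReal_ofReal hp.1]
  have hpos := measureReal_iInter_branchEvent_pos (fun l => by fun_prop) hind hp.2 hX
    (by simpa using hdp)
  have hsub : ⋂ n, branchEvent (fun l (ω : (cliqueWithTrees d).edgeSet → Bool) =>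
      ω (parentEdge i l)) n [] ⊆ {ω | HasInfiniteCluster (cliqueWithTrees d) ω} := by
    intro ω hω
    refine ⟨.inr (i, []), Set.infinite_of_injective_forall_mem
      (f := fun n => .inr (i, (exists_reachable_of_mem_branchEvent i n []
        (Set.mem_iInter.1 hω n)).choose)) (fun m n hmn => ?_) fun n =>
      (exists_reachable_of_mem_branchEvent i n [] (Set.mem_iInter.1 hω n)).choose_spec.2⟩
    have hm := (exists_reachable_of_mem_branchEvent i m [] (Set.mem_iInter.1 hω m)).choose_spec.1
    have hn := (exists_reachable_of_mem_branchEvent i n [] (Set.mem_iInter.1 hω n)).choose_spec.1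
    have heq := (Prod.ext_iff.1 (Sum.inr_injective hmn)).2
    simp only at heq
    rw [heq, hn] at hm
    simpa using hm.symm
  intro h0
  have hzero : μ (⋂ n, branchEvent (fun l ω => ω (parentEdge i l)) n []) = 0 :=
    le_antisymm (((measure_mono hsub).trans (infinitePi_le_bernoulliProduct _)).trans_eq h0)
      zero_le
  rw [measureReal_def, hzero] at hpos
  simp at hpos

theorem pc_cliqueWithTrees (hd : 2 ≤ d) : pc (cliqueWithTrees d) = 1 / ((d : ℝ) - 1) := by
  have hcast : ((d - 1 : ℕ) : ℝ) = (d : ℝ) - 1 := by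
    rw [Nat.cast_sub (by omega), Nat.cast_one]
  have hd' : (1 : ℝ) ≤ (d : ℝ) - 1 := by
    rw [← hcast]
    exact_mod_cast (by omega : 1 ≤ d - 1)
  have hpos : (0 : ℝ) < (d : ℝ) - 1 := by linarith
  have hmem {p : ℝ} (hp : 0 ≤ p) (hlt : p < 1 / ((d : ℝ) - 1)) :
      p ∈ {p : ℝ | p ∈ Set.Icc (0 : ℝ) 1 ∧ bernoulliProduct (cliqueWithTrees d).edgeSet p
        {ω | HasInfiniteCluster (cliqueWithTrees d) ω} = 0} := by
    have hp' : p ∈ Set.Icc (0 : ℝ) 1 := ⟨hp, hlt.le.trans ((div_le_one hpos).2 hd')⟩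
    refine ⟨hp', bernoulliProduct_hasInfiniteCluster_eq_zero cliqueWithTrees_neighborSet_finite
      cliqueWithTrees_neighborSet_ncard hp' ?_⟩
    rw [hcast, mul_comm]
    exact (lt_div_iff₀ hpos).1 hlt
  have hbdd : BddAbove {p : ℝ | p ∈ Set.Icc (0 : ℝ) 1 ∧ bernoulliProduct
      (cliqueWithTrees d).edgeSet p {ω | HasInfiniteCluster (cliqueWithTrees d) ω} = 0} :=
    ⟨1, fun p hp => hp.1.2⟩
  refine le_antisymm (csSup_le ⟨0, hmem le_rfl (by positivity)⟩ fun p hp => ?_) ?_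
  · by_contra! hlt
    refine bernoulliProduct_cliqueWithTrees_ne_zero (by omega) hp.1 ?_ hp.2
    rw [hcast, mul_comm]
    exact (div_lt_iff₀ hpos).1 hlt
  · refine le_of_forall_lt_imp_le_of_dense fun p hp => ?_
    rcases lt_or_ge p 0 with h | h
    · exact h.le.trans (le_csSup hbdd (hmem le_rfl (by positivity)))
    · exact le_csSup hbdd (hmem h hp)

end RegularGraph

/-- For every `d ≥ 3` there is a locally finite, connected, infinite,
`d`-regular simple graph `G` containing a cycle with `p_c(G) = 1/(d-1)`. -/
theorem exists_regular_graph_with_cycle_pc_eq (d : ℕ) (hd : 3 ≤ d) :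
    ∃ (V : Type) (G : SimpleGraph V), Infinite V ∧ G.Connected ∧
      (∀ v : V, (G.neighborSet v).Finite) ∧
      (∀ v : V, (G.neighborSet v).ncard = d) ∧
      ¬ G.IsAcyclic ∧
      pc G = 1 / ((d : ℝ) - 1) := by
  have : Nonempty (Fin d) := ⟨⟨0, by omega⟩⟩
  have : Nonempty (Fin (d - 1)) := ⟨⟨0, by omega⟩⟩
  refine ⟨_, cliqueWithTrees d, inferInstance, cliqueWithTrees_connected (by omega),
    cliqueWithTrees_neighborSet_finite, fun v => ?_, not_isAcyclic_cliqueWithTrees hd,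
    pc_cliqueWithTrees (by omega)⟩
  rw [cliqueWithTrees_neighborSet_ncard v]
  omega
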